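/- In the polynomial ring ℤ[t], for all integers p ≥ 3 and k ≥ 1, with B = Σ_{i=1}^{p−3} Σ_{j=1}^{k} (−t^{ikp+1} + t^{ikp+2} − t^{ikp+2+i} + t^{(ik+1)p})·t^{(j−1)p}, one has (1−t^p)·B = −t^{kp+1} + t^{(k+1)p} + (1−t)·Σ_{i=0}^{p−3} t^{(i+1)kp+i+2} + t^{kp(p−2)+1} − t^{kp(p−2)+2}. -/

import Mathlib

open Polynomial Finset

theorem one_sub_mul_sum_Icc_pow {R : Type*} [CommRing R] (x : R) (k : ℕ) :
    (1 - x) * ∑ j ∈ Icc 1 k, x ^ (j - 1) = 1 - x ^ k := by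
  induction k with
  | zero => simp
  | succ k ih =>
    rw [sum_Icc_succ_top (by lia), mul_add, ih, Nat.add_sub_cancel]
    ring

theorem one_sub_mul_sum_Icc_telescope {R : Type*} [CommRing R] (t T Q : R) (n : ℕ) :
    ∑ i ∈ Icc 1 n, (-t + t ^ 2 - t ^ (2 + i) + T) * Q ^ i * (1 - Q)
      = -(Q * t) + Q * T + (1 - t) * ∑ i ∈ range (n + 1), Q ^ (i + 1) * t ^ (i + 2)
        + Q ^ (n + 1) * (t - t ^ 2 - T + t ^ (n + 3)) := by
  induction n with
  | zero => simp; ring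
  | succ n ih =>
    rw [sum_Icc_succ_top (by lia), ih, sum_range_succ _ (n + 1)]
    ring

/-- In `ℤ[t]`, for integers `p ≥ 3` and `k ≥ 1`, with
`B = Σ_{i=1}^{p−3} Σ_{j=1}^{k} (−t^{ikp+1} + t^{ikp+2} − t^{ikp+2+i} + t^{(ik+1)p})·t^{(j−1)p}`,
one has
`(1−t^p)·B = −t^{kp+1} + t^{(k+1)p} + (1−t)·Σ_{i=0}^{p−3} t^{(i+1)kp+i+2}
  + t^{kp(p−2)+1} − t^{kp(p−2)+2}`. -/
theorem one_sub_tp_mul_B (p k : ℕ) (hp : 3 ≤ p) (hk : 1 ≤ k) :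
    (1 - (X : ℤ[X]) ^ p) *
      (∑ i ∈ Icc 1 (p - 3), ∑ j ∈ Icc 1 k,
        (-X ^ (i * k * p + 1) + X ^ (i * k * p + 2)
          - X ^ (i * k * p + 2 + i) + X ^ ((i * k + 1) * p)) * X ^ ((j - 1) * p))
    = -X ^ (k * p + 1) + X ^ ((k + 1) * p)
      + (1 - X) * (∑ i ∈ range (p - 2), X ^ ((i + 1) * k * p + i + 2))
      + X ^ (k * p * (p - 2) + 1) - X ^ (k * p * (p - 2) + 2) := by
  obtain ⟨n, rfl⟩ := Nat.exists_eq_add_of_le' hp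
  have inner_sum (i : ℕ) : (1 - (X : ℤ[X]) ^ (n + 3)) * ∑ j ∈ Icc 1 k,
      (-X ^ (i * k * (n + 3) + 1) + X ^ (i * k * (n + 3) + 2)
        - X ^ (i * k * (n + 3) + 2 + i) + X ^ ((i * k + 1) * (n + 3))) * X ^ ((j - 1) * (n + 3))
      = (-X + X ^ 2 - X ^ (2 + i) + X ^ (n + 3)) * (X ^ (k * (n + 3))) ^ i
        * (1 - X ^ (k * (n + 3))) := by
    have geom := one_sub_mul_sum_Icc_pow ((X : ℤ[X]) ^ (n + 3)) k
    simp only [← pow_mul, mul_comm (n + 3)] at geom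
    rw [← mul_sum, mul_left_comm, geom]
    ring
  have outer_sum (i : ℕ) : (X : ℤ[X]) ^ ((i + 1) * k * (n + 3) + i + 2)
      = (X ^ (k * (n + 3))) ^ (i + 1) * X ^ (i + 2) := by ring
  rw [mul_sum, sum_congr rfl fun i _ => inner_sum i, sum_congr rfl fun i _ => outer_sum i,
    Nat.add_sub_cancel, show n + 3 - 2 = n + 1 by lia, one_sub_mul_sum_Icc_telescope]
  ring
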